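/- arXiv:2408.02701 — 4 statements merged into one kernel-verified Lean document; each statement's English description precedes it below -/
import Mathlib

section
/- Let (Θ, 𝒜) be a measurable space, Q a probability measure on Θ, and R : Θ → ℝ² a bounded measurable function with nonnegative components. Let θ ∈ ℝ² and let λ° ∈ ℝ² with λ° ⪰ 0 componentwise. Suppose Z(λ°) = ∫ exp(−⟨λ°, R(ω)⟩) dQ(ω) ∈ (0,∞), and let S° be the probability measure with density dS°/dQ = exp(−⟨λ°, R⟩)/Z(λ°). If ∫ R dS° ⪯ θ componentwise and complementary slackness holds, i.e. λ°_i (θ_i − ∫ R_i dS°) = 0 for i = 1, 2, then for every probability measure S on Θ satisfying ∫ R dS ⪯ θ componentwise one has KL(S°‖Q) ≤ KL(S‖Q). In particular the Gibbs-form measure S° attains the primal minimum of KL(·‖Q) subject to the moment constraints E_S[R] ⪯ θ. -/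
open MeasureTheory Classical
open scoped ENNReal

/-- Kullback–Leibler divergence `∫ log(dP/dQ) dP ∈ [0,∞]` when `P ≪ Q` (and the
log-likelihood ratio is `P`-integrable), and `+∞` otherwise. -/
noncomputable def klDiv {α : Type*} [MeasurableSpace α] (P Q : Measure α) : ℝ≥0∞ :=
  if P ≪ Q ∧ Integrable (fun x => Real.log (P.rnDeriv Q x).toReal) P
  then ENNReal.ofReal (∫ x, Real.log (P.rnDeriv Q x).toReal ∂P)
  else ⊤

/-- **The Gibbs-form hyperprior attains the primal minimum** of `KL(·‖Q)` subject to the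
moment constraints `E_S[R] ⪯ θ`, given feasibility and complementary slackness. -/
theorem gibbs_attains_primal_minimum
    {Θ : Type*} [MeasurableSpace Θ]
    (Q : Measure Θ) [IsProbabilityMeasure Q]
    (R : Θ → ℝ × ℝ) (hRmeas : Measurable R)
    (hRbdd : ∃ Cb : ℝ, ∀ ω, ‖R ω‖ ≤ Cb)
    (hRnonneg : ∀ ω, 0 ≤ (R ω).1 ∧ 0 ≤ (R ω).2)
    (θv : ℝ × ℝ) (lo : ℝ × ℝ) (hlo : 0 ≤ lo.1 ∧ 0 ≤ lo.2)
    (Z : ℝ)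
    (hZ : Z = ∫ ω, Real.exp (-(lo.1 * (R ω).1 + lo.2 * (R ω).2)) ∂Q)
    (hZpos : 0 < Z)
    (So : Measure Θ)
    (hSo : So = Q.withDensity
      (fun ω => ENNReal.ofReal (Real.exp (-(lo.1 * (R ω).1 + lo.2 * (R ω).2)) / Z)))
    (hfeas1 : (∫ ω, (R ω).1 ∂So) ≤ θv.1) (hfeas2 : (∫ ω, (R ω).2 ∂So) ≤ θv.2)
    (hcs1 : lo.1 * (θv.1 - ∫ ω, (R ω).1 ∂So) = 0)
    (hcs2 : lo.2 * (θv.2 - ∫ ω, (R ω).2 ∂So) = 0)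
    (S : Measure Θ) [IsProbabilityMeasure S]
    (hSfeas1 : (∫ ω, (R ω).1 ∂S) ≤ θv.1) (hSfeas2 : (∫ ω, (R ω).2 ∂S) ≤ θv.2) :
    klDiv So Q ≤ klDiv S Q := by
  obtain ⟨Cb, hCb⟩ := hRbdd
  set f : Θ → ℝ := fun ω => -(lo.1 * (R ω).1 + lo.2 * (R ω).2) with hf
  have hm1 : Measurable fun ω => (R ω).1 := hRmeas.fst
  have hm2 : Measurable fun ω => (R ω).2 := hRmeas.snd
  have hfm : Measurable f := ((hm1.const_mul _).add (hm2.const_mul _)).neg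
  have hi1 : ∀ (P : Measure Θ) [IsProbabilityMeasure P], Integrable (fun ω => (R ω).1) P := by
    intro P _
    exact Integrable.of_bound hm1.aestronglyMeasurable Cb
      (ae_of_all _ fun ω => (norm_fst_le (R ω)).trans (hCb ω))
  have hi2 : ∀ (P : Measure Θ) [IsProbabilityMeasure P], Integrable (fun ω => (R ω).2) P := by
    intro P _
    exact Integrable.of_bound hm2.aestronglyMeasurable Cb
      (ae_of_all _ fun ω => (norm_snd_le (R ω)).trans (hCb ω))
  have hif : ∀ (P : Measure Θ) [IsProbabilityMeasure P], Integrable f P := by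
    intro P _
    exact (((hi1 P).const_mul _).add ((hi2 P).const_mul _)).neg
  have hintf : ∀ (P : Measure Θ) [IsProbabilityMeasure P],
      ∫ ω, f ω ∂P = -(lo.1 * ∫ ω, (R ω).1 ∂P + lo.2 * ∫ ω, (R ω).2 ∂P) := by
    intro P _
    simp only [hf]
    rw [integral_neg, integral_add ((hi1 P).const_mul _) ((hi2 P).const_mul _),
      integral_const_mul, integral_const_mul]
  have hexp : Integrable (fun ω => Real.exp (f ω)) Q := by
    refine Integrable.of_bound (Real.measurable_exp.comp hfm).aestronglyMeasurable 1
      (ae_of_all _ fun ω => ?_)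
    rw [Real.norm_eq_abs, abs_of_pos (Real.exp_pos _), Real.exp_le_one_iff]
    have := mul_nonneg hlo.1 (hRnonneg ω).1
    have := mul_nonneg hlo.2 (hRnonneg ω).2
    simp only [hf]; linarith
  have hSt : So = Q.tilted f := by rw [hSo, hZ]; rfl
  haveI hP : IsProbabilityMeasure (Q.tilted f) := isProbabilityMeasure_tilted hexp
  haveI hPo : IsProbabilityMeasure So := hSt ▸ hP
  have hac : So ≪ Q := hSt ▸ tilted_absolutelyContinuous Q f
  have hlog : (fun x => Real.log (So.rnDeriv Q x).toReal) =ᵐ[So] fun x => f x - Real.log Z := by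
    have h := log_rnDeriv_tilted_left_self (μ := Q) hexp
    rw [← hSt, ← hZ] at h
    exact hac.ae_le h
  unfold klDiv
  by_cases hS : S ≪ Q ∧ Integrable (fun x => Real.log (S.rnDeriv Q x).toReal) S
  swap
  · rw [if_neg hS]; exact le_top
  have hio : Integrable (fun x => Real.log (So.rnDeriv Q x).toReal) So :=
    (integrable_congr hlog).2 ((hif So).sub (integrable_const _))
  rw [if_pos hS, if_pos ⟨hac, hio⟩]
  apply ENNReal.ofReal_le_ofReal
  obtain ⟨hSQ, hSi⟩ := hS
  have hST : S ≪ Q.tilted f := hSQ.trans (absolutelyContinuous_tilted hexp)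
  have h1 := integral_llr_tilted_right hSQ (hif S) hexp hSi
  have h2 := InformationTheory.integral_llr_add_sub_measure_univ_nonneg hST
    (integrable_llr_tilted_right hSQ (hif S) hSi hexp)
  rw [h1, ← hZ, hintf S] at h2
  simp only [llr, probReal_univ] at h2
  rw [integral_congr_ae hlog, integral_sub (hif So) (integrable_const _), hintf So]
  simp only [integral_const, probReal_univ, one_smul]
  have := mul_le_mul_of_nonneg_left hSfeas1 hlo.1
  have := mul_le_mul_of_nonneg_left hSfeas2 hlo.2
  linarith
end

section
/- Let X and Y be compact metric spaces, μ₀ a Borel probability measure on X and ν₀ a Borel probability measure on Y. Let Θ = P(X × Y) be the space of Borel probability measures on X × Y with the Borel σ-algebra of the topology of weak convergence, let Q be a probability measure on Θ (the normalized adapted ideal hyperprior), and define R : Θ → [0,∞]² by R(π) = (KL(π₁‖μ₀), KL(π₂‖ν₀)), where π₁, π₂ are the two marginals of π. Assume R is measurable and bounded, and let θ = (η, ζ) with η > 0, ζ > 0. Assume the Slater condition: there exists a probability measure S* ≪ Q on Θ with KL(S*‖Q) < ∞, ∫ R₁ dS* < η and ∫ R₂ dS* < ζ. Then strong duality holds: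 inf { KL(S‖Q) : S a probability measure on Θ with ∫ R₁ dS ≤ η and ∫ R₂ dS ≤ ζ } = sup { −log( ∫ exp(−λ₁ R₁(π) − λ₂ R₂(π)) dQ(π) ) − λ₁ η − λ₂ ζ : λ₁ ≥ 0, λ₂ ≥ 0 }. -/
open MeasureTheory Classical
open scoped ENNReal

section HFPDHelpers

variable {Ω : Type*} [MeasurableSpace Ω]

theorem hfpd_bdd_integrable (S : Measure Ω) [IsFiniteMeasure S] {h : Ω → ℝ} {C : ℝ}
    (hm : Measurable h) (hb : ∀ x, |h x| ≤ C) : Integrable h S :=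
  Integrable.of_bound hm.aestronglyMeasurable C (Filter.Eventually.of_forall hb)

theorem hfpd_exp_integrable (S : Measure Ω) [IsFiniteMeasure S] {h : Ω → ℝ} {C : ℝ}
    (hm : Measurable h) (hb : ∀ x, |h x| ≤ C) : Integrable (fun x => Real.exp (h x)) S := by
  refine hfpd_bdd_integrable S (C := Real.exp C) hm.exp (fun x => ?_)
  rw [abs_of_pos (Real.exp_pos _)]
  exact Real.exp_le_exp.2 ((le_abs_self _).trans (hb x))

/-- Gibbs variational inequality. -/
theorem hfpd_gibbs (S Q : Measure Ω) [IsProbabilityMeasure S] [IsProbabilityMeasure Q]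
    {h : Ω → ℝ} {C : ℝ} (hm : Measurable h) (hb : ∀ x, |h x| ≤ C)
    (hac : S ≪ Q) (hint : Integrable (llr S Q) S) :
    ∫ x, h x ∂S - Real.log (∫ x, Real.exp (h x) ∂Q) ≤ ∫ x, llr S Q x ∂S := by
  have hS := hfpd_bdd_integrable S hm hb
  have hQ := hfpd_exp_integrable Q hm hb
  have hp : IsProbabilityMeasure (Q.tilted h) := isProbabilityMeasure_tilted hQ
  have h1 := InformationTheory.integral_llr_add_sub_measure_univ_nonneg
    (hac.trans (absolutelyContinuous_tilted hQ)) (integrable_llr_tilted_right hac hS hint hQ)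
  rw [integral_llr_tilted_right hac hS hQ hint] at h1
  simp at h1
  linarith

theorem hfpd_foc (S : Measure Ω) [IsProbabilityMeasure S] {f : Ω → ℝ} {C : ℝ}
    (hm : Measurable f) (hb : ∀ x, |f x| ≤ C) (η a : ℝ) (ha : 0 ≤ a)
    (H : ∀ t, -a ≤ t → 0 ≤ Real.log (∫ x, Real.exp (-t * f x) ∂S) + t * η) :
    ∫ x, f x ∂S ≤ η ∧ a * (η - ∫ x, f x ∂S) = 0 := by
  have hset : ProbabilityTheory.integrableExpSet f S = Set.univ := by
    ext t
    simp only [ProbabilityTheory.integrableExpSet, Set.mem_ofPred_eq, Set.mem_univ, iff_true]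
    refine hfpd_exp_integrable S (C := |t| * C) (hm.const_mul t) (fun x => ?_)
    rw [abs_mul]
    exact mul_le_mul_of_nonneg_left (hb x) (abs_nonneg _)
  have h0 : ∀ t : ℝ, t ∈ interior (ProbabilityTheory.integrableExpSet f S) := by
    simp [hset]
  have hd : HasDerivAt (ProbabilityTheory.cgf f S) (∫ x, f x ∂S) (-(0:ℝ)) := by
    have := (ProbabilityTheory.analyticAt_cgf (h0 0)).differentiableAt.hasDerivAt
    rw [ProbabilityTheory.deriv_cgf_zero (h0 0)] at this
    simpa using this
  have hd2 : HasDerivAt (fun t : ℝ => ProbabilityTheory.cgf f S (-t) + t * η)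
      (η - ∫ x, f x ∂S) 0 := by
    have h1 := (hd.scomp (0:ℝ) (hasDerivAt_neg (0:ℝ))).add ((hasDerivAt_id (0:ℝ)).mul_const η)
    refine HasDerivAt.congr_deriv (f := fun t : ℝ => ProbabilityTheory.cgf f S (-t) + t * η) h1 ?_
    simp only [smul_eq_mul]
    ring
  have H' : ∀ t, -a ≤ t → 0 ≤ ProbabilityTheory.cgf f S (-t) + t * η := H
  constructor
  · have ht := hd2.tendsto_slope_zero_right
    have := ge_of_tendsto (b := (0:ℝ)) ht (by
      filter_upwards [self_mem_nhdsWithin] with t ht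
      have ht' : (0:ℝ) < t := ht
      have := H' t (by linarith)
      simp only [zero_add, neg_zero, ProbabilityTheory.cgf_zero, zero_mul, sub_zero, smul_eq_mul,
        add_zero]
      positivity)
    linarith
  · rcases ha.eq_or_lt with h | h
    · simp [← h]
    · have hmin : IsLocalMin (fun t : ℝ => ProbabilityTheory.cgf f S (-t) + t * η) 0 := by
        filter_upwards [Ioi_mem_nhds (show -a < 0 by linarith)] with t ht
        simpa using H' t (le_of_lt ht)
      rw [hmin.hasDerivAt_eq_zero hd2, mul_zero]

/-- Attainment of the dual and construction of the primal optimum. -/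
theorem hfpd_core (Q : Measure Ω) [IsProbabilityMeasure Q] {f g : Ω → ℝ} {C : ℝ}
    (hf : Measurable f) (hg : Measurable g) (hf0 : ∀ x, 0 ≤ f x) (hg0 : ∀ x, 0 ≤ g x)
    (hfb : ∀ x, f x ≤ C) (hgb : ∀ x, g x ≤ C) (η ζ : ℝ)
    (S0 : Measure Ω) [IsProbabilityMeasure S0] (hac : S0 ≪ Q) (hint : Integrable (llr S0 Q) S0)
    (h1 : ∫ x, f x ∂S0 < η) (h2 : ∫ x, g x ∂S0 < ζ) :
    ∃ a b : ℝ, 0 ≤ a ∧ 0 ≤ b ∧ ∃ S : Measure Ω, IsProbabilityMeasure S ∧ S ≪ Q ∧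
      Integrable (llr S Q) S ∧ ∫ x, f x ∂S ≤ η ∧ ∫ x, g x ∂S ≤ ζ ∧
      ∫ x, llr S Q x ∂S =
        -(Real.log (∫ x, Real.exp (-(a * f x + b * g x)) ∂Q)) - a * η - b * ζ := by
  have hfa : ∀ x, |f x| ≤ C := fun x => by rw [abs_of_nonneg (hf0 x)]; exact hfb x
  have hga : ∀ x, |g x| ≤ C := fun x => by rw [abs_of_nonneg (hg0 x)]; exact hgb x
  have hhm : ∀ a b : ℝ, Measurable (fun x => -(a * f x + b * g x)) := fun a b => by fun_prop
  have hhb : ∀ a b : ℝ, ∀ x, |-(a * f x + b * g x)| ≤ |a| * C + |b| * C := fun a b x => by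
    rw [abs_neg]
    refine (abs_add_le _ _).trans ?_
    rw [abs_mul, abs_mul]
    exact add_le_add (mul_le_mul_of_nonneg_left (hfa x) (abs_nonneg _))
      (mul_le_mul_of_nonneg_left (hga x) (abs_nonneg _))
  have hei : ∀ a b : ℝ, Integrable (fun x => Real.exp (-(a * f x + b * g x))) Q :=
    fun a b => hfpd_exp_integrable Q (hhm a b) (hhb a b)
  have hlin : ∀ (S : Measure Ω) [IsProbabilityMeasure S] (a b : ℝ),
      ∫ x, -(a * f x + b * g x) ∂S = -(a * ∫ x, f x ∂S + b * ∫ x, g x ∂S) := by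
    intro S _ a b
    rw [integral_neg, integral_add ((hfpd_bdd_integrable S hf hfa).const_mul a)
      ((hfpd_bdd_integrable S hg hga).const_mul b), integral_const_mul, integral_const_mul]
  set F : ℝ × ℝ → ℝ := fun l =>
    Real.log (∫ x, Real.exp (-(l.1 * f x + l.2 * g x)) ∂Q) + l.1 * η + l.2 * ζ with hF
  set K := ∫ x, llr S0 Q x ∂S0 with hK
  have hcoer : ∀ a b : ℝ, -K + a * (η - ∫ x, f x ∂S0) + b * (ζ - ∫ x, g x ∂S0) ≤ F (a, b) := by
    intro a b
    have := hfpd_gibbs S0 Q (hhm a b) (hhb a b) hac hint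
    rw [hlin] at this
    simp only [hF]
    linarith
  have hF00 : F (0, 0) = 0 := by simp [hF]
  have hK0 : 0 ≤ K := by
    have := hcoer 0 0
    rw [hF00] at this
    linarith
  set d1 := η - ∫ x, f x ∂S0 with hd1
  set d2 := ζ - ∫ x, g x ∂S0 with hd2
  have hd1p : 0 < d1 := by linarith
  have hd2p : 0 < d2 := by linarith
  set T := K / d1 + K / d2 with hT
  have e1 : 0 ≤ K / d1 := by positivity
  have e2 : 0 ≤ K / d2 := by positivity
  have hcont : ContinuousOn F (Set.Icc 0 T ×ˢ Set.Icc 0 T) := by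
    have hc : ContinuousOn (fun l : ℝ × ℝ => ∫ x, Real.exp (-(l.1 * f x + l.2 * g x)) ∂Q)
        (Set.Icc 0 T ×ˢ Set.Icc 0 T) := by
      refine continuousOn_of_dominated (bound := fun _ => 1)
        (fun l _ => (hei l.1 l.2).aestronglyMeasurable) ?_ (integrable_const _) ?_
      · rintro ⟨a, b⟩ ⟨ha, hb⟩
        refine Filter.Eventually.of_forall fun x => ?_
        rw [Real.norm_of_nonneg (Real.exp_pos _).le, Real.exp_le_one_iff]
        have := mul_nonneg ha.1 (hf0 x)
        have := mul_nonneg hb.1 (hg0 x)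
        simp only at *
        linarith
      · exact Filter.Eventually.of_forall fun x => by fun_prop
    have hl := hc.log (fun l _ => (integral_exp_pos (hei l.1 l.2)).ne')
    exact (hl.add (by fun_prop)).add (by fun_prop)
  obtain ⟨⟨a, b⟩, ⟨ha, hb⟩, hmin⟩ := (isCompact_Icc.prod isCompact_Icc).exists_isMinOn
    ⟨((0:ℝ), (0:ℝ)), ⟨⟨le_rfl, by positivity⟩, ⟨le_rfl, by positivity⟩⟩⟩ hcont
  have hglob : ∀ a' b' : ℝ, 0 ≤ a' → 0 ≤ b' → F (a, b) ≤ F (a', b') := by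
    intro a' b' ha' hb'
    by_cases hin : a' ≤ T ∧ b' ≤ T
    · exact hmin (show (a', b') ∈ _ from ⟨⟨ha', hin.1⟩, ⟨hb', hin.2⟩⟩)
    · have h00 : F (a, b) ≤ F (0, 0) :=
        hmin (show ((0:ℝ), (0:ℝ)) ∈ _ from ⟨⟨le_rfl, by positivity⟩, ⟨le_rfl, by positivity⟩⟩)
      have hc := hcoer a' b'
      have p1 := mul_nonneg ha' hd1p.le
      have p2 := mul_nonneg hb' hd2p.le
      have : K ≤ a' * d1 + b' * d2 := by
        rw [not_and_or, not_le, not_le] at hin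
        rcases hin with h | h
        · have : K / d1 ≤ a' := by linarith
          rw [div_le_iff₀ hd1p] at this
          linarith
        · have : K / d2 ≤ b' := by linarith
          rw [div_le_iff₀ hd2p] at this
          linarith
      linarith
  have ha0 : 0 ≤ a := ha.1
  have hb0 : 0 ≤ b := hb.1
  set h : Ω → ℝ := fun x => -(a * f x + b * g x) with hh
  have hQ : Integrable (fun x => Real.exp (h x)) Q := hei a b
  have hp : IsProbabilityMeasure (Q.tilted h) := isProbabilityMeasure_tilted hQ
  have hZ : 0 < ∫ x, Real.exp (h x) ∂Q := integral_exp_pos hQ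
  have hac' : Q.tilted h ≪ Q := tilted_absolutelyContinuous _ _
  have key : ∀ u : Ω → ℝ, ∀ a' b' : ℝ, (∀ x, h x + u x = -(a' * f x + b' * g x)) →
      Real.log (∫ x, Real.exp (u x) ∂(Q.tilted h)) =
      (F (a', b') - a' * η - b' * ζ) - (F (a, b) - a * η - b * ζ) := by
    intro u a' b' hu
    rw [integral_exp_tilted]
    simp only [Pi.add_apply, hu]
    rw [Real.log_div (integral_exp_pos (hei a' b')).ne' hZ.ne']
    simp only [hF, hh]
    ring
  have foc1 := hfpd_foc (Q.tilted h) hf hfa η a ha0 (fun t ht => by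
    rw [key _ (a + t) b (fun x => by simp only [hh]; ring)]
    have := hglob (a + t) b (by linarith) hb0
    linarith)
  have foc2 := hfpd_foc (Q.tilted h) hg hga ζ b hb0 (fun t ht => by
    rw [key _ a (b + t) (fun x => by simp only [hh]; ring)]
    have := hglob a (b + t) ha0 (by linarith)
    linarith)
  have hllr : llr (Q.tilted h) Q =ᵐ[Q.tilted h] fun x => h x - Real.log (∫ x, Real.exp (h x) ∂Q) :=
    hac'.ae_le (log_rnDeriv_tilted_left_self hQ)
  have hhi : Integrable h (Q.tilted h) := hfpd_bdd_integrable _ (hhm a b) (hhb a b)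
  refine ⟨a, b, ha0, hb0, Q.tilted h, hp, hac', ?_, foc1.1, foc2.1, ?_⟩
  · exact (integrable_congr hllr).2 (hhi.sub (integrable_const _))
  · rw [integral_congr_ae hllr, integral_sub hhi (integrable_const _), hlin]
    simp only [integral_const, probReal_univ, smul_eq_mul, one_mul]
    have hZe : ∫ x, Real.exp (h x) ∂Q = ∫ x, Real.exp (-(a * f x + b * g x)) ∂Q := rfl
    rw [← hZe]
    linarith [foc1.2, foc2.2]

theorem hfpd_lint (S : Measure Ω) [IsProbabilityMeasure S] {R : Ω → ℝ≥0∞} {Cb : ℝ≥0∞}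
    (hm : Measurable R) (hC : Cb < ⊤) (hb : ∀ x, R x ≤ Cb) :
    ∫⁻ x, R x ∂S = ENNReal.ofReal (∫ x, (R x).toReal ∂S) := by
  have hi : Integrable (fun x => (R x).toReal) S :=
    hfpd_bdd_integrable S (C := Cb.toReal) hm.ennreal_toReal (fun x => by
      rw [abs_of_nonneg ENNReal.toReal_nonneg]
      exact ENNReal.toReal_mono hC.ne (hb x))
  rw [ofReal_integral_eq_lintegral_ofReal hi
    (Filter.Eventually.of_forall fun x => ENNReal.toReal_nonneg)]
  exact lintegral_congr fun x => (ENNReal.ofReal_toReal ((hb x).trans_lt hC).ne).symm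

theorem hfpd_kl_of (S Q : Measure Ω) (hac : S ≪ Q) (hint : Integrable (llr S Q) S) :
    klDiv S Q = ENNReal.ofReal (∫ x, llr S Q x ∂S) :=
  if_pos ⟨hac, hint⟩

theorem hfpd_kl_fin (S Q : Measure Ω) (h : klDiv S Q ≠ ⊤) :
    S ≪ Q ∧ Integrable (llr S Q) S := by
  by_contra hn
  exact h (if_neg hn)

theorem hfpd_abstract (Q : Measure Ω) [IsProbabilityMeasure Q] (R1 R2 : Ω → ℝ≥0∞)
    (hR1meas : Measurable R1) (hR2meas : Measurable R2)
    (hRbdd : ∃ Cb : ℝ≥0∞, Cb < ⊤ ∧ ∀ p, R1 p ≤ Cb ∧ R2 p ≤ Cb)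
    (η ζ : ℝ) (hη : 0 < η) (hζ : 0 < ζ)
    (hSlater : ∃ Sstar : Measure Ω,
      IsProbabilityMeasure Sstar ∧ Sstar ≪ Q ∧ klDiv Sstar Q < ⊤ ∧
      (∫⁻ p, R1 p ∂Sstar) < ENNReal.ofReal η ∧ (∫⁻ p, R2 p ∂Sstar) < ENNReal.ofReal ζ) :
    (⨅ (S : Measure Ω) (_ : IsProbabilityMeasure S)
        (_ : (∫⁻ p, R1 p ∂S) ≤ ENNReal.ofReal η) (_ : (∫⁻ p, R2 p ∂S) ≤ ENNReal.ofReal ζ),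
        klDiv S Q)
      =
    (⨆ (l : ℝ × ℝ) (_ : 0 ≤ l.1) (_ : 0 ≤ l.2),
        ENNReal.ofReal
          (-(Real.log (∫ p, Real.exp (-(l.1 * (R1 p).toReal + l.2 * (R2 p).toReal)) ∂Q))
            - l.1 * η - l.2 * ζ)) := by
  obtain ⟨Cb, hC, hb⟩ := hRbdd
  have hb1 : ∀ p, R1 p ≤ Cb := fun p => (hb p).1
  have hb2 : ∀ p, R2 p ≤ Cb := fun p => (hb p).2
  have ht1 : ∀ p, (R1 p).toReal ≤ Cb.toReal := fun p => ENNReal.toReal_mono hC.ne (hb1 p)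
  have ht2 : ∀ p, (R2 p).toReal ≤ Cb.toReal := fun p => ENNReal.toReal_mono hC.ne (hb2 p)
  have hm1 : Measurable fun p => (R1 p).toReal := hR1meas.ennreal_toReal
  have hm2 : Measurable fun p => (R2 p).toReal := hR2meas.ennreal_toReal
  apply le_antisymm
  · obtain ⟨S0, hS0, hac, hkl, h1, h2⟩ := hSlater
    obtain ⟨_, hint⟩ := hfpd_kl_fin S0 Q hkl.ne
    rw [hfpd_lint S0 hR1meas hC hb1, ENNReal.ofReal_lt_ofReal_iff hη] at h1
    rw [hfpd_lint S0 hR2meas hC hb2, ENNReal.ofReal_lt_ofReal_iff hζ] at h2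
    obtain ⟨a, b, ha, hb, S, hS, hSac, hSint, hS1, hS2, hSe⟩ := hfpd_core Q hm1 hm2
      (fun _ => ENNReal.toReal_nonneg) (fun _ => ENNReal.toReal_nonneg) ht1 ht2 η ζ S0 hac hint h1 h2
    refine le_trans (iInf_le_of_le S (iInf_le_of_le hS (iInf_le_of_le ?_ (iInf_le_of_le ?_ le_rfl)))) ?_
    · rw [hfpd_lint S hR1meas hC hb1]
      exact ENNReal.ofReal_le_ofReal hS1
    · rw [hfpd_lint S hR2meas hC hb2]
      exact ENNReal.ofReal_le_ofReal hS2
    · rw [hfpd_kl_of S Q hSac hSint, hSe]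
      exact le_iSup_of_le (a, b) (le_iSup_of_le ha (le_iSup_of_le hb le_rfl))
  · refine iSup_le fun l => iSup_le fun ha => iSup_le fun hb' => ?_
    refine le_iInf fun S => le_iInf fun hS => le_iInf fun h1 => le_iInf fun h2 => ?_
    by_cases hkl : klDiv S Q = ⊤
    · rw [hkl]; exact le_top
    obtain ⟨hac, hint⟩ := hfpd_kl_fin S Q hkl
    rw [hfpd_lint S hR1meas hC hb1, ENNReal.ofReal_le_ofReal_iff hη.le] at h1
    rw [hfpd_lint S hR2meas hC hb2, ENNReal.ofReal_le_ofReal_iff hζ.le] at h2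
    rw [hfpd_kl_of S Q hac hint]
    apply ENNReal.ofReal_le_ofReal
    have hfa : ∀ x, |(R1 x).toReal| ≤ Cb.toReal := fun x => by
      rw [abs_of_nonneg ENNReal.toReal_nonneg]; exact ht1 x
    have hga : ∀ x, |(R2 x).toReal| ≤ Cb.toReal := fun x => by
      rw [abs_of_nonneg ENNReal.toReal_nonneg]; exact ht2 x
    have hg := hfpd_gibbs S Q (h := fun p => -(l.1 * (R1 p).toReal + l.2 * (R2 p).toReal))
      (C := |l.1| * Cb.toReal + |l.2| * Cb.toReal) (by fun_prop) (fun x => by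
        rw [abs_neg]
        refine (abs_add_le _ _).trans ?_
        rw [abs_mul, abs_mul]
        exact add_le_add (mul_le_mul_of_nonneg_left (hfa x) (abs_nonneg _))
          (mul_le_mul_of_nonneg_left (hga x) (abs_nonneg _))) hac hint
    rw [integral_neg, integral_add ((hfpd_bdd_integrable S hm1 hfa).const_mul _)
      ((hfpd_bdd_integrable S hm2 hga).const_mul _), integral_const_mul, integral_const_mul] at hg
    have q1 := mul_le_mul_of_nonneg_left h1 ha
    have q2 := mul_le_mul_of_nonneg_left h2 hb'
    linarith

end HFPDHelpers

/-- **Strong duality for HFPD-OT** (Theorem 1(3)): on the space `Θ = P(X × Y)` of transport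
plans over compact metric spaces, with `R(π) = (KL(π₁‖μ₀), KL(π₂‖ν₀))` measurable and bounded
and under the Slater condition, the primal value
`inf { KL(S‖Q) : E_S[R₁] ≤ η, E_S[R₂] ≤ ζ }` equals the dual value
`sup_{λ ⪰ 0} −log ∫ exp(−λ₁R₁ − λ₂R₂) dQ − λ₁η − λ₂ζ`. -/
theorem hfpd_ot_strong_duality
    {X Y : Type*} [MetricSpace X] [CompactSpace X] [MetricSpace Y] [CompactSpace Y]
    [MeasurableSpace X] [BorelSpace X] [MeasurableSpace Y] [BorelSpace Y]
    [MeasurableSpace (ProbabilityMeasure (X × Y))] [BorelSpace (ProbabilityMeasure (X × Y))]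
    (μ0 : Measure X) [IsProbabilityMeasure μ0]
    (ν0 : Measure Y) [IsProbabilityMeasure ν0]
    (Q : Measure (ProbabilityMeasure (X × Y))) [IsProbabilityMeasure Q]
    (R1 R2 : ProbabilityMeasure (X × Y) → ℝ≥0∞)
    (hR1 : R1 = fun p => klDiv (p.toMeasure.map Prod.fst) μ0)
    (hR2 : R2 = fun p => klDiv (p.toMeasure.map Prod.snd) ν0)
    (hR1meas : Measurable R1) (hR2meas : Measurable R2)
    (hRbdd : ∃ Cb : ℝ≥0∞, Cb < ⊤ ∧ ∀ p, R1 p ≤ Cb ∧ R2 p ≤ Cb)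
    (η ζ : ℝ) (hη : 0 < η) (hζ : 0 < ζ)
    (hSlater : ∃ Sstar : Measure (ProbabilityMeasure (X × Y)),
      IsProbabilityMeasure Sstar ∧ Sstar ≪ Q ∧ klDiv Sstar Q < ⊤ ∧
      (∫⁻ p, R1 p ∂Sstar) < ENNReal.ofReal η ∧ (∫⁻ p, R2 p ∂Sstar) < ENNReal.ofReal ζ) :
    (⨅ (S : Measure (ProbabilityMeasure (X × Y))) (_ : IsProbabilityMeasure S)
        (_ : (∫⁻ p, R1 p ∂S) ≤ ENNReal.ofReal η) (_ : (∫⁻ p, R2 p ∂S) ≤ ENNReal.ofReal ζ),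
        klDiv S Q)
      =
    (⨆ (l : ℝ × ℝ) (_ : 0 ≤ l.1) (_ : 0 ≤ l.2),
        ENNReal.ofReal
          (-(Real.log (∫ p, Real.exp (-(l.1 * (R1 p).toReal + l.2 * (R2 p).toReal)) ∂Q))
            - l.1 * η - l.2 * ζ)) := by

  exact hfpd_abstract Q R1 R2 hR1meas hR2meas hRbdd η ζ hη hζ hSlater
end

section
/- Let X be a compact metric space and let P and Q be Borel probability measures on X with KL(P‖Q) < ∞. Then KL(P‖Q) = sup { ∫ u dP − ∫ exp(u − 1) dQ : u : X → ℝ bounded continuous }, and for every bounded continuous u : X → ℝ the inequality ∫ u dP − ∫ exp(u − 1) dQ ≤ KL(P‖Q) holds. -/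
open MeasureTheory Classical
open scoped ENNReal

open scoped BoundedContinuousFunction

theorem aux_approx
    {X : Type*} [MetricSpace X] [CompactSpace X]
    [MeasurableSpace X] [BorelSpace X]
    (P Q : Measure X) [IsProbabilityMeasure P] [IsProbabilityMeasure Q]
    (v : X → ℝ) (hv : Measurable v) (N : ℝ) (hN : ∀ x, |v x| ≤ N) (ε : ℝ) (hε : 0 < ε) :
    ∃ u : X →ᵇ ℝ, (∫ x, v x ∂P) - (∫ x, Real.exp (v x - 1) ∂Q) - ε
      ≤ (∫ x, u x ∂P) - (∫ x, Real.exp (u x - 1) ∂Q) := by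
  have hint : ∀ (R : Measure X) [IsFiniteMeasure R], Integrable v R := by
    intro R _
    exact Integrable.of_bound hv.aestronglyMeasurable N (ae_of_all _ hN)
  set δ := ε / (1 + Real.exp N) with hδ
  have hδ0 : 0 < δ := by positivity
  obtain ⟨g, hg, hgi⟩ := (hint (P + Q)).exists_boundedContinuous_integral_sub_le hδ0
  let u : X →ᵇ ℝ := BoundedContinuousFunction.mkOfCompact
    ⟨fun x => min (g x) N, g.continuous.min continuous_const⟩
  have hu : ∀ x, u x = min (g x) N := fun x => rfl
  have huN : ∀ x, u x ≤ N := fun x => min_le_right _ _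
  have huv : ∀ x, |v x - u x| ≤ ‖v x - g x‖ := by
    intro x
    rw [hu, Real.norm_eq_abs]
    have := (abs_le.1 (hN x)).2
    rcases le_total (g x) N with h | h
    · rw [min_eq_left h]
    · rw [min_eq_right h, abs_of_nonpos (by linarith), abs_of_nonpos (by linarith)]
      linarith
  have hdP : Integrable (fun x => ‖v x - g x‖) P := ((hint P).sub (g.integrable P)).norm
  have hdQ : Integrable (fun x => ‖v x - g x‖) Q := ((hint Q).sub (g.integrable Q)).norm
  rw [integral_add_measure hdP hdQ] at hg
  have hp0 : 0 ≤ ∫ x, ‖v x - g x‖ ∂P := integral_nonneg fun x => norm_nonneg _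
  have hq0 : 0 ≤ ∫ x, ‖v x - g x‖ ∂Q := integral_nonneg fun x => norm_nonneg _
  have h1 : (∫ x, v x ∂P) - ∫ x, u x ∂P ≤ ∫ x, ‖v x - g x‖ ∂P := by
    rw [← integral_sub (hint P) (u.integrable P)]
    exact integral_mono ((hint P).sub (u.integrable P)) hdP
      fun x => (le_abs_self _).trans (huv x)
  have hev : Integrable (fun x => Real.exp (v x - 1)) Q := by
    refine Integrable.of_bound (C := Real.exp N) (by fun_prop) (ae_of_all _ fun x => ?_)
    rw [Real.norm_eq_abs, Real.abs_exp, Real.exp_le_exp]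
    linarith [(abs_le.1 (hN x)).2]
  have heu : Integrable (fun x => Real.exp (u x - 1)) Q := by
    refine Integrable.of_bound (C := Real.exp N) ?_ (ae_of_all _ fun x => ?_)
    · exact (Real.continuous_exp.comp (u.continuous.sub continuous_const)).aestronglyMeasurable
    rw [Real.norm_eq_abs, Real.abs_exp, Real.exp_le_exp]
    linarith [huN x]
  have h2 : (∫ x, Real.exp (u x - 1) ∂Q) - ∫ x, Real.exp (v x - 1) ∂Q
      ≤ Real.exp N * ∫ x, ‖v x - g x‖ ∂Q := by
    rw [← integral_sub heu hev, ← integral_const_mul]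
    refine integral_mono (heu.sub hev) (hdQ.const_mul _) fun x => ?_
    have e1 : Real.exp (v x - 1) = Real.exp (u x - 1) * Real.exp (v x - u x) := by
      rw [← Real.exp_add]; ring_nf
    have e2 := Real.add_one_le_exp (v x - u x)
    have e3 : Real.exp (u x - 1) ≤ Real.exp N := Real.exp_le_exp.2 (by linarith [huN x])
    have e4 := Real.exp_pos (u x - 1)
    have e5 : -(v x - u x) ≤ ‖v x - g x‖ := (neg_le_abs _).trans (huv x)
    have e6 : Real.exp (u x - 1) * -(v x - u x) ≤ Real.exp N * ‖v x - g x‖ :=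
      (mul_le_mul_of_nonneg_left e5 e4.le).trans
        (mul_le_mul_of_nonneg_right e3 (norm_nonneg _))
    simp only [e1]
    nlinarith
  have h3 : δ * (1 + Real.exp N) = ε := by rw [hδ]; field_simp
  refine ⟨u, ?_⟩
  have h4 := Real.exp_pos N
  nlinarith

/-- **Variational (Fenchel) representation of the KL divergence** over bounded continuous test
functions: for Borel probability measures `P, Q` on a compact metric space with finite
divergence, every bounded continuous `u` satisfies
`∫ u dP − ∫ exp(u−1) dQ ≤ KL(P‖Q)`, and the supremum of these quantities equals `KL(P‖Q)`. -/
theorem klDiv_variational_representation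
    {X : Type*} [MetricSpace X] [CompactSpace X]
    [MeasurableSpace X] [BorelSpace X]
    (P Q : Measure X) [IsProbabilityMeasure P] [IsProbabilityMeasure Q]
    (hfin : klDiv P Q < ⊤) :
    (∀ u : X →ᵇ ℝ,
        (∫ x, u x ∂P) - (∫ x, Real.exp (u x - 1) ∂Q) ≤ (klDiv P Q).toReal)
    ∧ sSup (Set.range fun u : X →ᵇ ℝ =>
          (∫ x, u x ∂P) - (∫ x, Real.exp (u x - 1) ∂Q))
        = (klDiv P Q).toReal := by
  have hc : P ≪ Q ∧ Integrable (fun x => Real.log (P.rnDeriv Q x).toReal) P := by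
    by_contra h
    simp [klDiv, h] at hfin
  obtain ⟨hac, hlog⟩ := hc
  set f : X → ℝ := fun x => (P.rnDeriv Q x).toReal with hf
  have hfm : Measurable f := (Measure.measurable_rnDeriv P Q).ennreal_toReal
  have hf0 : ∀ x, 0 ≤ f x := fun x => ENNReal.toReal_nonneg
  have hkl : klDiv P Q = ENNReal.ofReal (∫ x, Real.log (f x) ∂P) := by
    rw [klDiv, if_pos ⟨hac, hlog⟩]
  have hfi : Integrable f Q := Measure.integrable_toReal_rnDeriv
  have hf1 : ∫ x, f x ∂Q = 1 := by
    rw [hf, Measure.integral_toReal_rnDeriv hac]; simp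
  have hfpos : ∀ᵐ x ∂P, 0 < f x := by
    filter_upwards [Measure.rnDeriv_pos hac, hac.ae_le (Measure.rnDeriv_lt_top P Q)] with x h1 h2
    exact ENNReal.toReal_pos h1.ne' h2.ne
  have hexp : ∀ u : X →ᵇ ℝ, Integrable (fun x => Real.exp (u x - 1)) Q := by
    intro u
    exact (BoundedContinuousFunction.mkOfCompact
      ⟨fun x => Real.exp (u x - 1),
        Real.continuous_exp.comp (u.continuous.sub continuous_const)⟩).integrable Q
  have hub : ∀ u : X →ᵇ ℝ, (∫ x, u x ∂P) - (∫ x, Real.exp (u x - 1) ∂Q)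
      ≤ ∫ x, Real.log (f x) ∂P := by
    intro u
    have i1 : Integrable (fun x => f x * u x) Q :=
      (integrable_rnDeriv_smul_iff hac (f := fun x => u x)).2 (u.integrable P)
    have i2 : Integrable (fun x => f x * Real.log (f x)) Q :=
      (integrable_rnDeriv_smul_iff hac (f := fun x => Real.log (f x))).2 hlog
    have j1 : ∫ x, f x * u x ∂Q = ∫ x, u x ∂P := integral_rnDeriv_smul hac (f := fun x => u x)
    have j2 : ∫ x, f x * Real.log (f x) ∂Q = ∫ x, Real.log (f x) ∂P :=
      integral_rnDeriv_smul hac (f := fun x => Real.log (f x))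
    rw [← j1, ← j2, ← integral_sub i1 (hexp u)]
    refine integral_mono (i1.sub (hexp u)) i2 fun x => ?_
    show f x * u x - Real.exp (u x - 1) ≤ f x * Real.log (f x)
    rcases (hf0 x).eq_or_lt with h | h
    · rw [← h]; simp; positivity
    · have e1 : Real.exp (u x - 1) = f x * Real.exp (u x - 1 - Real.log (f x)) := by
        rw [Real.exp_sub _ (Real.log _), Real.exp_log h]; field_simp
      have e2 := Real.add_one_le_exp (u x - 1 - Real.log (f x))
      rw [e1]
      nlinarith
  have hI0 : 0 ≤ ∫ x, Real.log (f x) ∂P := by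
    have := hub (BoundedContinuousFunction.const X 1)
    simpa using this
  have hkr : (klDiv P Q).toReal = ∫ x, Real.log (f x) ∂P := by
    rw [hkl, ENNReal.toReal_ofReal hI0]
  rw [hkr]
  refine ⟨hub, le_antisymm (csSup_le (Set.range_nonempty _) ?_) ?_⟩
  · rintro _ ⟨u, rfl⟩
    exact hub u
  have hbdd : BddAbove (Set.range fun u : X →ᵇ ℝ =>
      (∫ x, u x ∂P) - (∫ x, Real.exp (u x - 1) ∂Q)) := by
    refine ⟨∫ x, Real.log (f x) ∂P, ?_⟩
    rintro _ ⟨u, rfl⟩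
    exact hub u
  let g : ℕ → X → ℝ := fun n x => max (Real.exp (-(n:ℝ))) (min (f x) (Real.exp n))
  have hgpos : ∀ n x, 0 < g n x := fun n x => lt_max_of_lt_left (Real.exp_pos _)
  have hgm : ∀ n, Measurable (g n) := fun n =>
    measurable_const.max (hfm.min measurable_const)
  have hgle : ∀ n x, g n x ≤ f x + 1 := by
    intro n x
    refine max_le ?_ ((min_le_left _ _).trans (by linarith))
    have : Real.exp (-(n:ℝ)) ≤ 1 := Real.exp_le_one_iff.2 (by simp)
    linarith [hf0 x]
  have hgub : ∀ (n : ℕ) (x : X), g n x ≤ Real.exp n := by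
    intro n x
    refine max_le (Real.exp_le_exp.2 ?_) (min_le_right _ _)
    have : (0:ℝ) ≤ n := n.cast_nonneg
    linarith
  have hglb : ∀ (n : ℕ) (x : X), Real.exp (-(n:ℝ)) ≤ g n x := fun n x => le_max_left _ _
  have hlogb : ∀ (n : ℕ) (x : X), |Real.log (g n x)| ≤ n := by
    intro n x
    rw [abs_le]
    exact ⟨(Real.le_log_iff_exp_le (hgpos n x)).2 (hglb n x),
      (Real.log_le_iff_le_exp (hgpos n x)).2 (hgub n x)⟩
  have hlogf : ∀ n x, 0 < f x → |Real.log (g n x)| ≤ |Real.log (f x)| := by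
    intro n x hx
    have hn : (0:ℝ) ≤ n := n.cast_nonneg
    rcases le_total (f x) 1 with h | h
    · have a1 : g n x ≤ 1 := by
        refine max_le (Real.exp_le_one_iff.2 (by linarith)) ((min_le_left _ _).trans h)
      have a2 : f x ≤ g n x := by
        refine le_max_of_le_right (le_min le_rfl (h.trans (Real.one_le_exp hn)))
      rw [abs_of_nonpos (Real.log_nonpos (hgpos n x).le a1),
        abs_of_nonpos (Real.log_nonpos hx.le h)]
      linarith [Real.log_le_log hx a2]
    · have a1 : 1 ≤ g n x := le_max_of_le_right (le_min h (Real.one_le_exp hn))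
      have a2 : g n x ≤ f x :=
        max_le ((Real.exp_le_one_iff.2 (by linarith)).trans h) (min_le_left _ _)
      rw [abs_of_nonneg (Real.log_nonneg a1), abs_of_nonneg (Real.log_nonneg h)]
      exact Real.log_le_log (hgpos n x) a2
  have hgt : ∀ x, Filter.Tendsto (fun n => g n x) Filter.atTop (nhds (f x)) := by
    intro x
    have t1 : Filter.Tendsto (fun n : ℕ => Real.exp (-(n:ℝ))) Filter.atTop (nhds 0) :=
      Real.tendsto_exp_neg_atTop_nhds_zero.comp tendsto_natCast_atTop_atTop
    have t2 : Filter.Tendsto (fun n : ℕ => min (f x) (Real.exp n)) Filter.atTop (nhds (f x)) := by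
      refine tendsto_const_nhds.congr' ?_
      have := (Real.tendsto_exp_atTop.comp tendsto_natCast_atTop_atTop).eventually_ge_atTop (f x)
      filter_upwards [this] with n hn
      exact (min_eq_left hn).symm
    have := t1.max t2
    rwa [max_eq_right (hf0 x)] at this
  have hT1 : Filter.Tendsto (fun n => ∫ x, Real.log (g n x) ∂P) Filter.atTop
      (nhds (∫ x, Real.log (f x) ∂P)) := by
    refine tendsto_integral_of_dominated_convergence (fun x => |Real.log (f x)|)
      (fun n => (hgm n).log.aestronglyMeasurable) hlog.abs (fun n => ?_) ?_
    · filter_upwards [hfpos] with x hx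
      exact hlogf n x hx
    · filter_upwards [hfpos] with x hx
      exact (hgt x).log hx.ne'
  have hT2 : Filter.Tendsto (fun n => ∫ x, g n x ∂Q) Filter.atTop (nhds 1) := by
    rw [← hf1]
    refine tendsto_integral_of_dominated_convergence (fun x => f x + 1)
      (fun n => (hgm n).aestronglyMeasurable) (hfi.add (integrable_const _)) (fun n => ?_) ?_
    · refine ae_of_all _ fun x => ?_
      rw [Real.norm_eq_abs, abs_of_pos (hgpos n x)]
      exact hgle n x
    · exact ae_of_all _ hgt
  have hT : Filter.Tendsto (fun n => 1 + (∫ x, Real.log (g n x) ∂P) - ∫ x, g n x ∂Q)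
      Filter.atTop (nhds (∫ x, Real.log (f x) ∂P)) := by
    have := (hT1.const_add 1).sub hT2
    simpa using this
  refine le_of_tendsto' hT fun n => ?_
  refine le_of_forall_pos_le_add fun ε hε => ?_
  obtain ⟨u, hu⟩ := aux_approx P Q (fun x => 1 + Real.log (g n x))
    (measurable_const.add (hgm n).log) (1 + n)
    (fun x => (abs_add_le _ _).trans (by simpa using hlogb n x)) ε hε
  have hle := le_csSup hbdd ⟨u, rfl⟩
  have k1 : ∫ x, (1 + Real.log (g n x)) ∂P = 1 + ∫ x, Real.log (g n x) ∂P := by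
    rw [integral_add (integrable_const _)]
    · simp
    · exact Integrable.of_bound (hgm n).log.aestronglyMeasurable n (ae_of_all _ (hlogb n))
  have k2 : ∫ x, Real.exp (1 + Real.log (g n x) - 1) ∂Q = ∫ x, g n x ∂Q := by
    congr 1
    ext x
    rw [add_sub_cancel_left, Real.exp_log (hgpos n x)]
  rw [k1, k2] at hu
  simp only at hle
  linarith
end

section
/- Let (Θ, 𝒜) be a measurable space, Q a probability measure on Θ, and R : Θ → ℝ² a bounded measurable function with nonnegative components. Let θ = (η, ζ) with η > 0, ζ > 0, and assume the Slater condition: there exists a probability measure S* ≪ Q with KL(S*‖Q) < ∞, ∫ R₁ dS* < η and ∫ R₂ dS* < ζ. Then the supremum over λ ⪰ 0 of the dual objective λ ↦ −log( ∫ exp(−⟨λ, R(ω)⟩) dQ(ω) ) − ⟨λ, θ⟩ is attained at some λ° ⪰ 0. -/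
open MeasureTheory Classical
open scoped ENNReal

open MeasureTheory Classical in
theorem gibbs_aux {Θ : Type*} [MeasurableSpace Θ] (Q S : Measure Θ) [IsProbabilityMeasure Q]
    [IsProbabilityMeasure S] (hS : S ≪ Q) (hi : Integrable (llr S Q) S) (f : Θ → ℝ)
    (hfS : Integrable f S) (hfQ : Integrable (fun x => Real.exp (f x)) Q) :
    -(Real.log (∫ ω, Real.exp (f ω) ∂Q)) ≤ ∫ x, llr S Q x ∂S - ∫ x, f x ∂S := by
  have h1 := integral_llr_tilted_right hS hfS hfQ hi
  have : IsProbabilityMeasure (Q.tilted f) := isProbabilityMeasure_tilted hfQ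
  have h2 := InformationTheory.integral_llr_add_sub_measure_univ_nonneg
    (hS.trans (absolutelyContinuous_tilted hfQ)) (integrable_llr_tilted_right hS hfS hi hfQ)
  simp at h2
  linarith

/-- **Attainment of the dual maximum under the Slater condition**: the supremum over `λ ⪰ 0`
of the dual objective `λ ↦ −log ∫ exp(−⟨λ,R⟩) dQ − ⟨λ,θ⟩` is attained at some `λ° ⪰ 0`. -/
theorem dual_supremum_attained
    {Θ : Type*} [MeasurableSpace Θ]
    (Q : Measure Θ) [IsProbabilityMeasure Q]
    (R : Θ → ℝ × ℝ) (hRmeas : Measurable R)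
    (hRbdd : ∃ Cb : ℝ, ∀ ω, ‖R ω‖ ≤ Cb)
    (hRnonneg : ∀ ω, 0 ≤ (R ω).1 ∧ 0 ≤ (R ω).2)
    (η ζ : ℝ) (hη : 0 < η) (hζ : 0 < ζ)
    (hSlater : ∃ Sstar : Measure Θ, IsProbabilityMeasure Sstar ∧ Sstar ≪ Q ∧
      klDiv Sstar Q < ⊤ ∧ (∫ ω, (R ω).1 ∂Sstar) < η ∧ (∫ ω, (R ω).2 ∂Sstar) < ζ) :
    ∃ lo : ℝ × ℝ, 0 ≤ lo.1 ∧ 0 ≤ lo.2 ∧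
      ∀ l : ℝ × ℝ, 0 ≤ l.1 → 0 ≤ l.2 →
        -(Real.log (∫ ω, Real.exp (-(l.1 * (R ω).1 + l.2 * (R ω).2)) ∂Q))
            - (l.1 * η + l.2 * ζ)
          ≤ -(Real.log (∫ ω, Real.exp (-(lo.1 * (R ω).1 + lo.2 * (R ω).2)) ∂Q))
            - (lo.1 * η + lo.2 * ζ) := by
  obtain ⟨C, hC⟩ := hRbdd
  obtain ⟨S, hSp, hSQ, hkl, hS1, hS2⟩ := hSlater
  have hi : Integrable (llr S Q) S := by
    unfold klDiv at hkl
    split_ifs at hkl with h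
    · exact h.2
    · exact absurd hkl (lt_irrefl _)
  have hm1 : Measurable fun ω => (R ω).1 := hRmeas.fst
  have hm2 : Measurable fun ω => (R ω).2 := hRmeas.snd
  have hI1 : Integrable (fun ω => (R ω).1) S :=
    Integrable.of_bound hm1.aestronglyMeasurable C
      (Filter.Eventually.of_forall fun ω => (norm_fst_le _).trans (hC ω))
  have hI2 : Integrable (fun ω => (R ω).2) S :=
    Integrable.of_bound hm2.aestronglyMeasurable C
      (Filter.Eventually.of_forall fun ω => (norm_snd_le _).trans (hC ω))
  have hmE : ∀ l : ℝ × ℝ, Measurable fun ω => Real.exp (-(l.1 * (R ω).1 + l.2 * (R ω).2)) :=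
    fun l => by fun_prop
  have hE : ∀ l : ℝ × ℝ, 0 ≤ l.1 → 0 ≤ l.2 → ∀ ω,
      ‖Real.exp (-(l.1 * (R ω).1 + l.2 * (R ω).2))‖ ≤ 1 := by
    intro l h1 h2 ω
    rw [Real.norm_eq_abs, Real.abs_exp, Real.exp_le_one_iff]
    have := mul_nonneg h1 (hRnonneg ω).1
    have := mul_nonneg h2 (hRnonneg ω).2
    linarith
  have hEi : ∀ l : ℝ × ℝ, 0 ≤ l.1 → 0 ≤ l.2 →
      Integrable (fun ω => Real.exp (-(l.1 * (R ω).1 + l.2 * (R ω).2))) Q := fun l h1 h2 =>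
    Integrable.of_bound (hmE l).aestronglyMeasurable 1 (Filter.Eventually.of_forall (hE l h1 h2))
  obtain ⟨δ, hδ, hδ1, hδ2⟩ : ∃ δ : ℝ, 0 < δ ∧ δ ≤ η - (∫ ω, (R ω).1 ∂S) ∧
      δ ≤ ζ - (∫ ω, (R ω).2 ∂S) :=
    ⟨min (η - (∫ ω, (R ω).1 ∂S)) (ζ - (∫ ω, (R ω).2 ∂S)),
      lt_min (by linarith) (by linarith), min_le_left _ _, min_le_right _ _⟩
  set K := ∫ x, llr S Q x ∂S with hK
  have hbound : ∀ l : ℝ × ℝ, 0 ≤ l.1 → 0 ≤ l.2 →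
      -(Real.log (∫ ω, Real.exp (-(l.1 * (R ω).1 + l.2 * (R ω).2)) ∂Q))
            - (l.1 * η + l.2 * ζ) ≤ K - δ * (l.1 + l.2) := by
    intro l h1 h2
    have h := gibbs_aux Q S hSQ hi (fun ω => -(l.1 * (R ω).1 + l.2 * (R ω).2))
      ((hI1.const_mul _).add (hI2.const_mul _)).neg (hEi l h1 h2)
    rw [integral_neg, integral_add (hI1.const_mul _) (hI2.const_mul _), integral_const_mul,
      integral_const_mul, ← hK] at h
    have := mul_le_mul_of_nonneg_left hδ1 h1
    have := mul_le_mul_of_nonneg_left hδ2 h2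
    linarith
  have hcpt : IsCompact (Set.Icc (0 : ℝ × ℝ) (|K| / δ, |K| / δ)) := isCompact_Icc
  have hKd : 0 ≤ |K| / δ := by positivity
  have h0 : (0 : ℝ × ℝ) ∈ Set.Icc (0 : ℝ × ℝ) (|K| / δ, |K| / δ) :=
    ⟨le_rfl, ⟨hKd, hKd⟩⟩
  have hcont : ContinuousOn (fun l : ℝ × ℝ =>
      -(Real.log (∫ ω, Real.exp (-(l.1 * (R ω).1 + l.2 * (R ω).2)) ∂Q))
            - (l.1 * η + l.2 * ζ)) (Set.Icc (0 : ℝ × ℝ) (|K| / δ, |K| / δ)) := by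
    refine ContinuousOn.sub (ContinuousOn.neg (ContinuousOn.log ?_ ?_)) (by fun_prop)
    · refine continuousOn_of_dominated (bound := fun _ => 1)
        (fun l _ => (hmE l).aestronglyMeasurable)
        (fun l hl => Filter.Eventually.of_forall (hE l hl.1.1 hl.1.2)) (integrable_const _)
        (Filter.Eventually.of_forall fun ω => by fun_prop)
    · intro l hl
      exact (integral_exp_pos (hEi l hl.1.1 hl.1.2)).ne'
  obtain ⟨lo, hlo, hmax⟩ := hcpt.exists_isMaxOn ⟨0, h0⟩ hcont
  refine ⟨lo, hlo.1.1, hlo.1.2, fun l h1 h2 => ?_⟩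
  by_cases hl : l ∈ Set.Icc (0 : ℝ × ℝ) (|K| / δ, |K| / δ)
  · exact hmax hl
  · refine le_trans ?_ (hmax h0)
    have hb := hbound l h1 h2
    have : |K| < δ * (l.1 + l.2) := by
      by_contra! hcon
      have h3 : l.1 + l.2 ≤ |K| / δ := by
        rw [le_div_iff₀ hδ]; linarith
      refine hl ⟨⟨h1, h2⟩, ⟨?_, ?_⟩⟩
      · show l.1 ≤ |K| / δ
        linarith
      · show l.2 ≤ |K| / δ
        linarith
    have h4 := le_abs_self K
    simp only [Set.mem_setOf_eq, Prod.fst_zero, Prod.snd_zero, zero_mul, add_zero, neg_zero,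
      Real.exp_zero, integral_const, probReal_univ, smul_eq_mul, mul_one, Real.log_one, sub_zero]
    linarith
end
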